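/- arXiv:2301.12448 — 10 statements merged into one kernel-verified Lean document; each statement's English description precedes it below -/
import Mathlib

section
/- Let V and H be finite-dimensional complex inner product spaces and let T_R, T_L : V → H be injective linear maps. Then G := T_L† ∘ T_R is bijective if and only if there exists an idempotent linear operator P on H (P ∘ P = P) with range P = range T_R and range P† = range T_L. -/
/-- For injective linear maps `T_R, T_L : V → H` between
finite-dimensional complex inner product spaces, `G := T_L† ∘ T_R` is bijective
iff there exists an idempotent operator `P` on `H` with `range P = range T_R`
and `range P† = range T_L`. -/
theorem stmt2
    {V H : Type*}
    [NormedAddCommGroup V] [InnerProductSpace ℂ V] [FiniteDimensional ℂ V]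
    [NormedAddCommGroup H] [InnerProductSpace ℂ H] [FiniteDimensional ℂ H]
    (TR TL : V →ₗ[ℂ] H)
    (hTR : Function.Injective TR) (hTL : Function.Injective TL) :
    Function.Bijective ((LinearMap.adjoint TL) ∘ₗ TR) ↔
      ∃ P : H →ₗ[ℂ] H, P ∘ₗ P = P ∧
        LinearMap.range P = LinearMap.range TR ∧
        LinearMap.range (LinearMap.adjoint P) = LinearMap.range TL := by
  constructor
  · intro hG
    let e := LinearEquiv.ofBijective (LinearMap.adjoint TL ∘ₗ TR) hG
    have he : ∀ v, e.symm (LinearMap.adjoint TL (TR v)) = v := fun v =>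
      e.symm_apply_apply v
    refine ⟨TR ∘ₗ e.symm.toLinearMap ∘ₗ LinearMap.adjoint TL, ?_, ?_, ?_⟩
    · ext x
      simp [he]
    · apply le_antisymm
      · rintro _ ⟨x, rfl⟩
        exact ⟨_, rfl⟩
      · rintro _ ⟨v, rfl⟩
        exact ⟨TR v, by simp [he]⟩
    · have hk : LinearMap.ker (TR ∘ₗ e.symm.toLinearMap ∘ₗ LinearMap.adjoint TL)
          = LinearMap.ker (LinearMap.adjoint TL) := by
        ext x
        simp [map_eq_zero_iff TR hTR]
      rw [← LinearMap.orthogonal_ker, hk, LinearMap.orthogonal_ker,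
        LinearMap.adjoint_adjoint]
  · rintro ⟨P, hP, hR, hL⟩
    have hk : LinearMap.ker P = LinearMap.ker (LinearMap.adjoint TL) := by
      rw [← LinearMap.orthogonal_range TL, ← hL, LinearMap.orthogonal_range,
        LinearMap.adjoint_adjoint]
    have hinj : Function.Injective (LinearMap.adjoint TL ∘ₗ TR) := by
      rw [injective_iff_map_eq_zero]
      intro v hv
      have h1 : TR v ∈ LinearMap.ker P := by
        rw [hk]
        exact hv
      have h2 : TR v ∈ LinearMap.range P := by
        rw [hR]
        exact ⟨v, rfl⟩
      obtain ⟨x, hx⟩ := h2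
      have h3 : P (P x) = P x := LinearMap.congr_fun hP x
      rw [hx, LinearMap.mem_ker.mp h1] at h3
      exact (map_eq_zero_iff TR hTR).mp h3.symm
    exact ⟨hinj, LinearMap.injective_iff_surjective.mp hinj⟩
end

section
/- For every real μ > 0, every integer N ≥ 1, and every tuple (i₁, …, i_N) ∈ {+1, 0, −1}^N, one has Tr(A_μ^{[i_N]} · A_μ^{[i_{N−1}]} · ⋯ · A_μ^{[i_1]}) = (−μ)^N · Tr(A_{1/μ}^{[i_1]} · A_{1/μ}^{[i_2]} · ⋯ · A_{1/μ}^{[i_N]}). (Hence the parity-reflected asymmetric AKLT state with parameter μ is proportional, with factor (−μ)^N, to the asymmetric AKLT state with parameter 1/μ.) -/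
open Matrix

/-- Local tensors of the asymmetric AKLT state: physical index `0 ↦ +1`,
`1 ↦ 0`, `2 ↦ −1`; virtual index `0 ↦ ↑`, `1 ↦ ↓`. -/
noncomputable def asymA (μ : ℝ) : Fin 3 → Matrix (Fin 2) (Fin 2) ℝ :=
  ![!![0, 0; -Real.sqrt μ, 0],
    !![1 / Real.sqrt 2, 0; 0, -μ / Real.sqrt 2],
    !![0, Real.sqrt μ; 0, 0]]

lemma asymA_transpose (μ : ℝ) (hμ : 0 < μ) (j : Fin 3) :
    (asymA μ j)ᵀ = (-μ) • (!![0, 1; -1, 0] * asymA (1/μ) j * !![0, -1; 1, 0]) := by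
  have h1 : μ * (Real.sqrt μ)⁻¹ = Real.sqrt μ := by
    rw [← div_eq_mul_inv, Real.div_sqrt]
  have h2 : μ ≠ 0 := hμ.ne'
  fin_cases j <;> ext a b <;> fin_cases a <;> fin_cases b <;>
    simp [asymA, h1] <;> field_simp

lemma asymA_list (μ : ℝ) (hμ : 0 < μ) (l : List (Fin 3)) :
    ((l.map (asymA μ)).reverse.prod)ᵀ =
      (-μ) ^ l.length • (!![0, 1; -1, 0] * (l.map (asymA (1/μ))).prod * !![0, -1; 1, 0]) := by
  have hW : (!![0, -1; 1, 0] * !![0, 1; -1, 0] : Matrix (Fin 2) (Fin 2) ℝ) = 1 := by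
    ext a b; fin_cases a <;> fin_cases b <;> simp
  have hV : (!![0, 1; -1, 0] * !![0, -1; 1, 0] : Matrix (Fin 2) (Fin 2) ℝ) = 1 := by
    ext a b; fin_cases a <;> fin_cases b <;> simp
  induction l with
  | nil => simp only [List.map_nil, List.reverse_nil, List.prod_nil, List.length_nil, pow_zero,
      one_smul, mul_one, Matrix.transpose_one, hV]
  | cons j l ih =>
    simp only [List.map_cons, List.reverse_cons, List.prod_append, List.prod_nil, Matrix.transpose_one, one_mul,
      Matrix.transpose_mul, ih, asymA_transpose μ hμ j, List.prod_cons, List.length_cons]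
    rw [smul_mul_smul_comm, pow_succ']
    congr 1
    generalize (!![0, 1; -1, 0] : Matrix (Fin 2) (Fin 2) ℝ) = W at *
    generalize (!![0, -1; 1, 0] : Matrix (Fin 2) (Fin 2) ℝ) = V at *
    simp only [mul_assoc]
    rw [← mul_assoc V W, hW, one_mul]

/-- For every `μ > 0`, `N ≥ 1` and tuple `(i₁,…,i_N)`,
`Tr(A_μ^{[i_N]} ⋯ A_μ^{[i_1]}) = (−μ)^N · Tr(A_{1/μ}^{[i_1]} ⋯ A_{1/μ}^{[i_N]})`. -/
theorem stmt6 (μ : ℝ) (hμ : 0 < μ) (N : ℕ) (hN : 1 ≤ N) (i : Fin N → Fin 3) :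
    ((List.ofFn fun k => asymA μ (i k)).reverse.prod).trace =
      (-μ) ^ N * ((List.ofFn fun k => asymA (1/μ) (i k)).prod).trace := by
  have hW : (!![0, -1; 1, 0] * !![0, 1; -1, 0] : Matrix (Fin 2) (Fin 2) ℝ) = 1 := by
    ext a b; fin_cases a <;> fin_cases b <;> simp
  have e : ∀ ν : ℝ, (List.ofFn fun k => asymA ν (i k)) = (List.ofFn i).map (asymA ν) := by
    intro ν
    rw [List.map_ofFn]; rfl
  rw [e, e, ← Matrix.trace_transpose, asymA_list μ hμ, List.length_ofFn, Matrix.trace_smul,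
    Matrix.trace_mul_comm, ← mul_assoc, hW, one_mul, smul_eq_mul]
end

section
/- For every real μ with 1/3 < μ < 3, the matrix powers ((−2/(3μ)) · E_μ)^k converge entrywise, as k → ∞, to the rank-one matrix (1/2) · v vᵀ, where v = (0, −1, 1, 0) in the basis (↑↑, ↑↓, ↓↑, ↓↓). (This is the renormalization fixed point of the transfer matrix in the nontrivial phase.) -/
open Matrix Kronecker

/-- The 4×4 transfer matrix `E_μ = Σ_i (A_μ^{[i]})ᵀ ⊗ A_μ^{[i]}`, rows and columns
indexed by pairs `(α,β) ∈ {↑,↓}²` in the order `(↑↑,↑↓,↓↑,↓↓)`. -/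
noncomputable def transferE (μ : ℝ) : Matrix (Fin 2 × Fin 2) (Fin 2 × Fin 2) ℝ :=
  ∑ i : Fin 3, (asymA μ i)ᵀ ⊗ₖ (asymA μ i)

/-- The vector `v = (0, −1, 1, 0)` in the basis `(↑↑, ↑↓, ↓↑, ↓↓)`. -/
def domVec : Fin 2 × Fin 2 → ℝ := fun p => if p = (0, 1) then -1 else if p = (1, 0) then 1 else 0

/-- Normal form of the powers: eigenvalues `x` on `↑↑`, `y` on `↓↓`, `1` on the antisymmetric and
`z` on the symmetric vector of the middle block. -/
noncomputable def auxF (x y z : ℝ) : Matrix (Fin 2 × Fin 2) (Fin 2 × Fin 2) ℝ :=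
  fun p q => (![![![![x, 0], ![0, 0]], ![![0, (1 + z) / 2], ![(z - 1) / 2, 0]]],
    ![![![0, (z - 1) / 2], ![(1 + z) / 2, 0]], ![![0, 0], ![0, y]]]] :
      Fin 2 → Fin 2 → Fin 2 → Fin 2 → ℝ) p.1 p.2 q.1 q.2

lemma auxF_one : auxF 1 1 1 = 1 := by
  ext ⟨a, b⟩ ⟨c, d⟩
  fin_cases a <;> fin_cases b <;> fin_cases c <;> fin_cases d <;>
    simp [auxF, Matrix.one_apply]

lemma auxF_mul (x y z x' y' z' : ℝ) :
    auxF x y z * auxF x' y' z' = auxF (x * x') (y * y') (z * z') := by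
  ext ⟨a, b⟩ ⟨c, d⟩
  fin_cases a <;> fin_cases b <;> fin_cases c <;> fin_cases d <;>
    simp [auxF, Matrix.mul_apply, Fintype.sum_prod_type] <;> ring

lemma auxF_pow (x y z : ℝ) (k : ℕ) : auxF x y z ^ k = auxF (x ^ k) (y ^ k) (z ^ k) := by
  induction k with
  | zero => simp [auxF_one]
  | succ k ih => rw [pow_succ, ih, auxF_mul, pow_succ, pow_succ, pow_succ]

lemma transferE_eq (μ : ℝ) (h : 0 < μ) :
    (-2/(3*μ)) • transferE μ = auxF (-1/(3*μ)) (-μ/3) (-1/3) := by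
  have h1 : √μ * √μ = μ := Real.mul_self_sqrt h.le
  have h2 : √2 * √2 = (2:ℝ) := Real.mul_self_sqrt (by norm_num)
  have h3 : (√2)⁻¹ * (√2)⁻¹ = (1/2:ℝ) := by rw [← mul_inv, h2]; norm_num
  have h4 : (√2) ^ 2 = (2:ℝ) := by rw [sq, h2]
  ext ⟨a, b⟩ ⟨c, d⟩
  fin_cases a <;> fin_cases b <;> fin_cases c <;> fin_cases d <;>
    simp [auxF, transferE, asymA, Fin.sum_univ_three, Matrix.sum_apply, h1, h3] <;>
    field_simp <;> (try rw [h4]) <;> norm_num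

/-- for `1/3 < μ < 3`, `((−2/(3μ)) · E_μ)^k` converges entrywise, as
`k → ∞`, to the rank-one matrix `(1/2) · v vᵀ` with `v = (0,−1,1,0)`. -/
theorem stmt8 (μ : ℝ) (hμ₁ : 1/3 < μ) (hμ₂ : μ < 3) (p q : Fin 2 × Fin 2) :
    Filter.Tendsto (fun k : ℕ => (((-2/(3*μ)) • transferE μ) ^ k) p q)
      Filter.atTop (nhds (((1/2 : ℝ) • Matrix.vecMulVec domVec domVec) p q)) := by
  have h0 : 0 < μ := by linarith
  rw [transferE_eq μ h0]
  simp only [auxF_pow]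
  have hx : Filter.Tendsto (fun k : ℕ => (-1/(3*μ)) ^ k) Filter.atTop (nhds 0) := by
    apply tendsto_pow_atTop_nhds_zero_of_abs_lt_one
    rw [abs_div, abs_neg, abs_one, abs_of_pos (by positivity), div_lt_one (by positivity)]
    linarith
  have hy : Filter.Tendsto (fun k : ℕ => (-μ/3) ^ k) Filter.atTop (nhds 0) := by
    apply tendsto_pow_atTop_nhds_zero_of_abs_lt_one
    rw [abs_lt]
    constructor <;> linarith
  have hz : Filter.Tendsto (fun k : ℕ => (-1/3 : ℝ) ^ k) Filter.atTop (nhds 0) := by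
    apply tendsto_pow_atTop_nhds_zero_of_abs_lt_one
    rw [abs_lt]
    constructor <;> norm_num
  have hp : Filter.Tendsto (fun k : ℕ => (1 + (-1/3 : ℝ) ^ k) / 2) Filter.atTop (nhds (1/2)) := by
    simpa using (hz.const_add 1).div_const 2
  have hm : Filter.Tendsto (fun k : ℕ => ((-1/3 : ℝ) ^ k - 1) / 2) Filter.atTop
      (nhds (-(1/2))) := by
    have := (hz.sub_const 1).div_const 2
    convert this using 2
    norm_num
  obtain ⟨a, b⟩ := p
  obtain ⟨c, d⟩ := q
  fin_cases a <;> fin_cases b <;> fin_cases c <;> fin_cases d <;>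
    simp [auxF, domVec, Matrix.vecMulVec_apply] <;>
    first
    | simpa using hx
    | simpa using hy
    | simpa using hp
    | simpa using hm
end

section
/- For every real μ > 0, the four vectors v_{↑↑}(μ), v_{↑↓}(μ), v_{↓↑}(μ), v_{↓↓}(μ) in ℝ⁹ are linearly independent. (This is the injectivity of the asymmetric AKLT matrix product state after blocking two sites.) -/
open Matrix

/-- The two-site blocked vectors `v_{αβ}(μ) ∈ ℝ⁹ = ℝ³ ⊗ ℝ³`, with components
`v_{αβ}(μ)[i,j] = (A_μ^{[i]} A_μ^{[j]})_{αβ}`. -/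
noncomputable def blockedVec (μ : ℝ) (p : Fin 2 × Fin 2) : Fin 3 × Fin 3 → ℝ :=
  fun q => (asymA μ q.1 * asymA μ q.2) p.1 p.2

/-- for every `μ > 0`, the four vectors `v_{↑↑}(μ), v_{↑↓}(μ),
v_{↓↑}(μ), v_{↓↓}(μ)` in `ℝ⁹` are linearly independent (injectivity of the
asymmetric AKLT MPS after blocking two sites). -/
theorem stmt10 (μ : ℝ) (hμ : 0 < μ) :
    LinearIndependent ℝ (fun p : Fin 2 × Fin 2 => blockedVec μ p) := by
  have hs : Real.sqrt μ ≠ 0 := (Real.sqrt_pos.mpr hμ).ne'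
  have h2 : Real.sqrt 2 ≠ 0 := (Real.sqrt_pos.mpr (by norm_num)).ne'
  have hm : μ ≠ 0 := hμ.ne'
  rw [Fintype.linearIndependent_iff]
  intro g hg
  have e1 := congrFun hg (2, 0)
  have e2 := congrFun hg (0, 2)
  have e3 := congrFun hg (1, 2)
  have e4 := congrFun hg (1, 0)
  simp [Fintype.sum_prod_type, Fin.sum_univ_two, blockedVec, asymA, Matrix.mul_apply,
    hs, hm] at e1 e2 e3 e4
  rintro ⟨a, b⟩
  fin_cases a <;> fin_cases b <;> simp_all
end

section
/- For every real μ > 0, the 9×9 real matrix Π(μ) is idempotent, Π(μ) · Π(μ) = Π(μ), and has rank 5. -/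
open Matrix Kronecker

/-- The spin-1 operator `Sᶻ` in the basis `(|+1⟩, |0⟩, |−1⟩)`. -/
def spinZ : Matrix (Fin 3) (Fin 3) ℝ := !![1, 0, 0; 0, 0, 0; 0, 0, -1]

/-- The spin-1 raising operator `S⁺` in the basis `(|+1⟩, |0⟩, |−1⟩)`. -/
noncomputable def spinP : Matrix (Fin 3) (Fin 3) ℝ :=
  !![0, Real.sqrt 2, 0; 0, 0, Real.sqrt 2; 0, 0, 0]

/-- The spin-1 lowering operator `S⁻ = (S⁺)ᵀ`. -/
noncomputable def spinM : Matrix (Fin 3) (Fin 3) ℝ := spinPᵀ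

/-- `S^{+z} = S⁺Sᶻ + SᶻS⁺`. -/
noncomputable def spinPZ : Matrix (Fin 3) (Fin 3) ℝ := spinP * spinZ + spinZ * spinP

/-- `S^{−z} = S⁻Sᶻ + SᶻS⁻`. -/
noncomputable def spinMZ : Matrix (Fin 3) (Fin 3) ℝ := spinM * spinZ + spinZ * spinM

/-- The two-site local Hamiltonian term `Π(μ)` on `ℝ³ ⊗ ℝ³` (a 9×9 real matrix). -/
noncomputable def projPi (μ : ℝ) : Matrix (Fin 3 × Fin 3) (Fin 3 × Fin 3) ℝ :=
  (5/12 : ℝ) • ((μ/2) • (spinM ⊗ₖ spinP) + (1/(2*μ)) • (spinP ⊗ₖ spinM) + spinZ ⊗ₖ spinZ)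
  + (2/3 : ℝ) • ((1 : Matrix (Fin 3) (Fin 3) ℝ) ⊗ₖ (1 : Matrix (Fin 3) (Fin 3) ℝ))
  + (1/6 : ℝ) • ((μ^2/4) • ((spinM^2) ⊗ₖ (spinP^2)) + (1/(4*μ^2)) • ((spinP^2) ⊗ₖ (spinM^2))
      - (spinZ^2) ⊗ₖ (1 : Matrix (Fin 3) (Fin 3) ℝ)
      - (1 : Matrix (Fin 3) (Fin 3) ℝ) ⊗ₖ (spinZ^2))
  + (1/24 : ℝ) • (μ • (spinMZ ⊗ₖ spinPZ) + (1/μ) • (spinPZ ⊗ₖ spinMZ))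
  + (1/4 : ℝ) • ((spinZ^2) ⊗ₖ (spinZ^2))

/-- Columns spanning the range of `Π(μ)`. -/
noncomputable def colC (μ : ℝ) : Matrix (Fin 3 × Fin 3) (Fin 5) ℝ :=
  Matrix.of fun i k =>
    (![!![1, 0, 0, 0, 0; 0, 1, 0, 0, 0; 0, 0, 1, 0, 0],
       !![0, μ, 0, 0, 0; 0, 0, 2 * μ, 0, 0; 0, 0, 0, 1, 0],
       !![0, 0, μ ^ 2, 0, 0; 0, 0, 0, μ, 0; 0, 0, 0, 0, 1]] i.1 :
         Matrix (Fin 3) (Fin 5) ℝ) i.2 k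

/-- Dual rows. -/
noncomputable def rowD (μ : ℝ) : Matrix (Fin 5) (Fin 3 × Fin 3) ℝ :=
  Matrix.of fun k i =>
    (![!![1, 0, 0, 0, 0; 0, 1/2, 0, 0, 0; 0, 0, 1/6, 0, 0],
       !![0, 1/(2*μ), 0, 0, 0; 0, 0, 1/(3*μ), 0, 0; 0, 0, 0, 1/2, 0],
       !![0, 0, 1/(6*μ^2), 0, 0; 0, 0, 0, 1/(2*μ), 0; 0, 0, 0, 0, 1]] i.1 :
         Matrix (Fin 3) (Fin 5) ℝ) i.2 k

lemma rowD_mul_colC (μ : ℝ) (hμ : 0 < μ) : rowD μ * colC μ = 1 := by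
  have h0 : μ ≠ 0 := hμ.ne'
  ext k l
  fin_cases k <;> fin_cases l <;>
    simp [Matrix.mul_apply, Fintype.sum_prod_type, Fin.sum_univ_succ, rowD, colC] <;>
    field_simp <;> norm_num

set_option maxHeartbeats 4000000 in
lemma projPi_eq (μ : ℝ) (hμ : 0 < μ) : projPi μ = colC μ * rowD μ := by
  have h0 : μ ≠ 0 := hμ.ne'
  have h2 : Real.sqrt 2 * Real.sqrt 2 = 2 := Real.mul_self_sqrt (by norm_num)
  have hM : spinM = !![0, 0, 0; Real.sqrt 2, 0, 0; 0, Real.sqrt 2, 0] := by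
    ext i j; fin_cases i <;> fin_cases j <;> simp [spinM, spinP]
  have hPZ : spinPZ = !![0, Real.sqrt 2, 0; 0, 0, -Real.sqrt 2; 0, 0, 0] := by
    ext i j; fin_cases i <;> fin_cases j <;>
      simp [spinPZ, spinP, spinZ, Matrix.mul_apply, Fin.sum_univ_succ]
  have hMZ : spinMZ = !![0, 0, 0; Real.sqrt 2, 0, 0; 0, -Real.sqrt 2, 0] := by
    ext i j; fin_cases i <;> fin_cases j <;>
      simp [spinMZ, hM, spinZ, Matrix.mul_apply, Fin.sum_univ_succ]
  have hP2 : spinP ^ 2 = !![0, 0, 2; 0, 0, 0; 0, 0, 0] := by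
    ext i j; fin_cases i <;> fin_cases j <;>
      simp [pow_two, spinP, Matrix.mul_apply, Fin.sum_univ_succ]
  have hM2 : spinM ^ 2 = !![0, 0, 0; 0, 0, 0; 2, 0, 0] := by
    ext i j; fin_cases i <;> fin_cases j <;>
      simp [pow_two, hM, Matrix.mul_apply, Fin.sum_univ_succ]
  have hZ2 : spinZ ^ 2 = !![1, 0, 0; 0, 0, 0; 0, 0, 1] := by
    ext i j; fin_cases i <;> fin_cases j <;>
      simp [pow_two, spinZ, Matrix.mul_apply, Fin.sum_univ_succ]
  unfold projPi
  rw [hP2, hM2, hZ2, hPZ, hMZ, hM]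
  ext ⟨a, b⟩ ⟨c, d⟩
  fin_cases a <;> fin_cases b <;> fin_cases c <;> fin_cases d <;>
    simp [Matrix.mul_apply, Fin.sum_univ_succ, rowD, colC, spinP, spinZ, h2] <;>
    field_simp <;> norm_num

/-- for every `μ > 0`, `Π(μ)` is idempotent and has rank 5. -/
theorem stmt11 (μ : ℝ) (hμ : 0 < μ) :
    projPi μ * projPi μ = projPi μ ∧ (projPi μ).rank = 5 := by
  have hDC := rowD_mul_colC μ hμ
  rw [projPi_eq μ hμ]
  constructor
  · rw [Matrix.mul_assoc, ← Matrix.mul_assoc (rowD μ), hDC, Matrix.one_mul]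
  · apply le_antisymm
    · exact (Matrix.rank_mul_le_left _ _).trans ((Matrix.rank_le_card_width (colC μ)).trans (by simp))
    · have h : rowD μ * (colC μ * rowD μ) * colC μ = 1 := by
        rw [← Matrix.mul_assoc, hDC, Matrix.one_mul, hDC]
      calc 5 = (rowD μ * (colC μ * rowD μ) * colC μ).rank := by rw [h, Matrix.rank_one]; simp
        _ ≤ (rowD μ * (colC μ * rowD μ)).rank := Matrix.rank_mul_le_left _ _
        _ ≤ _ := Matrix.rank_mul_le_right _ _
end

section
/- For every real μ > 0 and all α, β ∈ {↑,↓}: Π(μ) · v_{αβ}(μ) = 0. (The local Hamiltonian term annihilates the two-site support space of the right ground state, so the asymmetric AKLT state is a zero mode of Π(μ).) -/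
open Matrix Kronecker

/-- `S⁻` in explicit form. -/
lemma spinM_eq : spinM = !![0, 0, 0; Real.sqrt 2, 0, 0; 0, Real.sqrt 2, 0] := by
  ext i j; fin_cases i <;> fin_cases j <;> simp [spinM, spinP]

lemma spinP_sq : spinP ^ 2 = !![0, 0, 2; 0, 0, 0; 0, 0, 0] := by
  ext i j; fin_cases i <;> fin_cases j <;> simp [pow_two, spinP, Matrix.mul_apply, Fin.sum_univ_three]

lemma spinM_sq : spinM ^ 2 = !![0, 0, 0; 0, 0, 0; 2, 0, 0] := by
  rw [spinM_eq]
  ext i j; fin_cases i <;> fin_cases j <;> simp [pow_two, Matrix.mul_apply, Fin.sum_univ_three]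

lemma spinZ_sq : spinZ ^ 2 = !![1, 0, 0; 0, 0, 0; 0, 0, 1] := by
  ext i j; fin_cases i <;> fin_cases j <;> simp [pow_two, spinZ, Matrix.mul_apply, Fin.sum_univ_three]

lemma spinPZ_eq : spinPZ = !![0, Real.sqrt 2, 0; 0, 0, -Real.sqrt 2; 0, 0, 0] := by
  ext i j; fin_cases i <;> fin_cases j <;>
    simp [spinPZ, spinP, spinZ, Matrix.mul_apply, Fin.sum_univ_three]

lemma spinMZ_eq : spinMZ = !![0, 0, 0; Real.sqrt 2, 0, 0; 0, -Real.sqrt 2, 0] := by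
  rw [spinMZ, spinM_eq]
  ext i j; fin_cases i <;> fin_cases j <;>
    simp [spinZ, Matrix.mul_apply, Fin.sum_univ_three]

set_option maxHeartbeats 4000000 in
/-- for every `μ > 0` and all `α, β ∈ {↑,↓}`, `Π(μ) · v_{αβ}(μ) = 0`:
the local Hamiltonian term annihilates the two-site support space of the right
ground state. -/
theorem stmt12 (μ : ℝ) (hμ : 0 < μ) (p : Fin 2 × Fin 2) :
    (projPi μ).mulVec (blockedVec μ p) = 0 := by
  have h2 : Real.sqrt 2 * Real.sqrt 2 = 2 := Real.mul_self_sqrt (by norm_num)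
  have hm : Real.sqrt μ * Real.sqrt μ = μ := Real.mul_self_sqrt hμ.le
  have h20 : Real.sqrt 2 ≠ 0 := by positivity
  have hμ0 : μ ≠ 0 := hμ.ne'
  obtain ⟨a, b⟩ := p
  ext ⟨i, j⟩
  rw [projPi, spinP_sq, spinM_sq, spinZ_sq, spinPZ_eq, spinMZ_eq, spinM_eq]
  simp only [Matrix.mulVec, dotProduct, Fintype.sum_prod_type, Fin.sum_univ_three, blockedVec,
    Matrix.mul_apply, Fin.sum_univ_two]
  generalize Real.sqrt μ = m at *
  fin_cases a <;> fin_cases b <;> fin_cases i <;> fin_cases j <;>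
    simp [spinP, spinZ, asymA, Matrix.one_apply] <;>
    field_simp <;> grind
end

section
/- For every real μ > 0: (i) Π(μ)ᵀ = Π(1/μ); (ii) W · Π(μ) · W = Π(1/μ), where W is the 9×9 swap matrix determined by W(x ⊗ y) = y ⊗ x for all x, y ∈ ℝ³; consequently (iii) W · Π(μ)ᵀ · W = Π(μ), i.e. Π(μ) is pseudo-Hermitian with respect to the parity (swap) operator. -/
open Matrix Kronecker

/-- The 9×9 swap (parity) matrix `W`, determined by `W(x ⊗ y) = y ⊗ x`. -/
def swapW : Matrix (Fin 3 × Fin 3) (Fin 3 × Fin 3) ℝ :=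
  Matrix.of fun p q => if p.1 = q.2 ∧ p.2 = q.1 then 1 else 0

/-- Conjugation by the swap matrix exchanges the two tensor factors of the indices. -/
theorem swapW_conj (X : Matrix (Fin 3 × Fin 3) (Fin 3 × Fin 3) ℝ) :
    swapW * X * swapW = X.submatrix Prod.swap Prod.swap := by
  have hl : ∀ Y : Matrix (Fin 3 × Fin 3) (Fin 3 × Fin 3) ℝ,
      swapW * Y = Y.submatrix Prod.swap id := by
    intro Y
    ext p q
    rw [Matrix.mul_apply, Finset.sum_eq_single p.swap]
    · simp [swapW]
    · rintro ⟨b1, b2⟩ _ hb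
      have : ¬ (p.1 = b2 ∧ p.2 = b1) := by
        rintro ⟨h1, h2⟩
        exact hb (by simp [Prod.ext_iff, h1, h2])
      simp [swapW, this]
    · simp
  have ht : swapWᵀ = swapW := by
    ext p q
    simp only [swapW, Matrix.transpose_apply, Matrix.of_apply]
    congr 1
    exact propext ⟨fun h => ⟨h.2.symm, h.1.symm⟩, fun h => ⟨h.2.symm, h.1.symm⟩⟩
  have hr : ∀ Y : Matrix (Fin 3 × Fin 3) (Fin 3 × Fin 3) ℝ,
      Y * swapW = Y.submatrix id Prod.swap := by
    intro Y
    have := congrArg Matrix.transpose (hl Yᵀ)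
    rw [Matrix.transpose_mul, ht, Matrix.transpose_transpose] at this
    rw [this]
    rfl
  rw [hl, hr]
  rfl

theorem projPi_transpose (μ : ℝ) : (projPi μ)ᵀ = projPi (1/μ) := by
  have hz : spinZᵀ = spinZ := by
    ext i j
    fin_cases i <;> fin_cases j <;> simp [spinZ]
  have hm : spinMᵀ = spinP := by simp [spinM]
  have hp : spinPᵀ = spinM := rfl
  have hpz : spinPZᵀ = spinMZ := by
    simp [spinPZ, spinMZ, hz, hp, Matrix.transpose_mul, add_comm]
  have hmz : spinMZᵀ = spinPZ := by rw [← hpz, Matrix.transpose_transpose]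
  have hk : ∀ A B : Matrix (Fin 3) (Fin 3) ℝ, (A ⊗ₖ B)ᵀ = Aᵀ ⊗ₖ Bᵀ := fun A B => rfl
  have e1 : 1 / μ / 2 = 1 / (2 * μ) := by ring
  have e2 : 1 / (2 * (1 / μ)) = μ / 2 := by simp; ring
  have e3 : (1 / μ) ^ 2 / 4 = 1 / (4 * μ ^ 2) := by ring
  have e4 : 1 / (4 * (1 / μ) ^ 2) = μ ^ 2 / 4 := by simp; ring
  have e5 : 1 / (1 / μ) = μ := by simp
  unfold projPi
  rw [e1, e2, e3, e4, e5]
  simp only [Matrix.transpose_add, Matrix.transpose_sub, Matrix.transpose_smul, hk,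
    Matrix.transpose_pow, hz, hm, hp, hpz, hmz, Matrix.transpose_one]
  module

theorem projPi_swap (μ : ℝ) :
    (projPi μ).submatrix Prod.swap Prod.swap = projPi (1/μ) := by
  have hk : ∀ A B : Matrix (Fin 3) (Fin 3) ℝ,
      (A ⊗ₖ B).submatrix Prod.swap Prod.swap = B ⊗ₖ A := by
    intro A B
    ext p q
    simp [Matrix.kroneckerMap_apply, mul_comm]
  have ha : ∀ A B : Matrix (Fin 3 × Fin 3) (Fin 3 × Fin 3) ℝ,
      (A + B).submatrix Prod.swap Prod.swap =
        A.submatrix Prod.swap Prod.swap + B.submatrix Prod.swap Prod.swap := fun _ _ => rfl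
  have hs : ∀ A B : Matrix (Fin 3 × Fin 3) (Fin 3 × Fin 3) ℝ,
      (A - B).submatrix Prod.swap Prod.swap =
        A.submatrix Prod.swap Prod.swap - B.submatrix Prod.swap Prod.swap := fun _ _ => rfl
  have hc : ∀ (c : ℝ) (A : Matrix (Fin 3 × Fin 3) (Fin 3 × Fin 3) ℝ),
      (c • A).submatrix Prod.swap Prod.swap =
        c • A.submatrix Prod.swap Prod.swap := fun _ _ => rfl
  have e1 : 1 / μ / 2 = 1 / (2 * μ) := by ring
  have e2 : 1 / (2 * (1 / μ)) = μ / 2 := by simp; ring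
  have e3 : (1 / μ) ^ 2 / 4 = 1 / (4 * μ ^ 2) := by ring
  have e4 : 1 / (4 * (1 / μ) ^ 2) = μ ^ 2 / 4 := by simp; ring
  have e5 : 1 / (1 / μ) = μ := by simp
  unfold projPi
  rw [e1, e2, e3, e4, e5]
  simp only [ha, hs, hc, hk]
  module

/-- for every `μ > 0`: (i) `Π(μ)ᵀ = Π(1/μ)`;
(ii) `W · Π(μ) · W = Π(1/μ)`; and consequently (iii) `W · Π(μ)ᵀ · W = Π(μ)`,
i.e. `Π(μ)` is pseudo-Hermitian with respect to the parity (swap) operator. -/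
theorem stmt14 (μ : ℝ) (hμ : 0 < μ) :
    (projPi μ)ᵀ = projPi (1/μ) ∧
    swapW * projPi μ * swapW = projPi (1/μ) ∧
    swapW * (projPi μ)ᵀ * swapW = projPi μ := by
  refine ⟨projPi_transpose μ, ?_, ?_⟩
  · rw [swapW_conj, projPi_swap]
  · rw [swapW_conj, projPi_transpose, projPi_swap, one_div_one_div]
end

section
/- Let D_μ := diag(μ, 1, 1/μ) (a real 3×3 matrix in the spin-1 basis (|+1⟩, |0⟩, |−1⟩)). For every real μ > 0 and every natural number n: (D_μⁿ ⊗ D_μ^{n+1}) · Π(1) = Π(μ) · (D_μⁿ ⊗ D_μ^{n+1}). In particular, Π(μ) is similar to Π(1), so the open-boundary Hamiltonian built from the terms Π(μ) has a spectrum independent of μ. -/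
open Matrix Kronecker

/-- The diagonal gauge matrix `D_μ = diag(μ, 1, 1/μ)` in the spin-1 basis. -/
noncomputable def gaugeD (μ : ℝ) : Matrix (Fin 3) (Fin 3) ℝ := !![μ, 0, 0; 0, 1, 0; 0, 0, 1/μ]

/-- A quasi-commutation relation passes to powers. -/
lemma pow_quasi {D A : Matrix (Fin 3) (Fin 3) ℝ} {c : ℝ} (h : D * A = c • (A * D)) (n : ℕ) :
    D ^ n * A = c ^ n • (A * D ^ n) := by
  induction n with
  | zero => simp
  | succ k ih =>
    rw [pow_succ, mul_assoc, h, mul_smul_comm, ← mul_assoc, ih, smul_mul_assoc, smul_smul,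
      mul_assoc, pow_succ, mul_comm c]

/-- Products of quasi-commuting matrices quasi-commute. -/
lemma mul_quasi {D A B : Matrix (Fin 3) (Fin 3) ℝ} {a b : ℝ} (hA : D * A = a • (A * D))
    (hB : D * B = b • (B * D)) : D * (A * B) = (a * b) • (A * B * D) := by
  rw [← mul_assoc, hA, smul_mul_assoc, mul_assoc, hB, mul_smul_comm, smul_smul, mul_assoc]

/-- The Kronecker version with powers `n` and `n + 1`. -/
lemma kron_quasi {D A B : Matrix (Fin 3) (Fin 3) ℝ} {a b : ℝ} (hA : D * A = a • (A * D))
    (hB : D * B = b • (B * D)) (hab : a * b = 1) (n : ℕ) :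
    ((D ^ n) ⊗ₖ (D ^ (n + 1))) * (A ⊗ₖ B) = b • ((A ⊗ₖ B) * ((D ^ n) ⊗ₖ (D ^ (n + 1)))) := by
  have e : a ^ n * b ^ (n + 1) = b := by
    rw [pow_succ, ← mul_assoc, ← mul_pow, hab, one_pow, one_mul]
  rw [← Matrix.mul_kronecker_mul, ← Matrix.mul_kronecker_mul, pow_quasi hA, pow_quasi hB,
    Matrix.smul_kronecker, Matrix.kronecker_smul, smul_smul, e]

lemma quasi_P (μ : ℝ) (hμ : μ ≠ 0) : gaugeD μ * spinP = μ • (spinP * gaugeD μ) := by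
  ext i j
  fin_cases i <;> fin_cases j <;>
    simp [gaugeD, spinP, Matrix.mul_apply, Fin.sum_univ_three] <;> field_simp

lemma quasi_M (μ : ℝ) (hμ : μ ≠ 0) : gaugeD μ * spinM = μ⁻¹ • (spinM * gaugeD μ) := by
  ext i j
  fin_cases i <;> fin_cases j <;>
    simp [gaugeD, spinM, spinP, Matrix.mul_apply, Fin.sum_univ_three] <;> field_simp

lemma quasi_Z (μ : ℝ) : gaugeD μ * spinZ = (1 : ℝ) • (spinZ * gaugeD μ) := by
  ext i j
  fin_cases i <;> fin_cases j <;>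
    simp [gaugeD, spinZ, Matrix.mul_apply, Fin.sum_univ_three]

/-- for every `μ > 0` and every `n : ℕ`,
`(D_μⁿ ⊗ D_μ^{n+1}) · Π(1) = Π(μ) · (D_μⁿ ⊗ D_μ^{n+1})`; in particular `Π(μ)` is
similar to `Π(1)`, so the open-boundary Hamiltonian built from the terms `Π(μ)`
has a spectrum independent of `μ`. -/
theorem stmt15 (μ : ℝ) (hμ : 0 < μ) (n : ℕ) :
    ((gaugeD μ ^ n) ⊗ₖ (gaugeD μ ^ (n + 1))) * projPi 1 =
      projPi μ * ((gaugeD μ ^ n) ⊗ₖ (gaugeD μ ^ (n + 1))) := by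
  have h0 : μ ≠ 0 := hμ.ne'
  have hP := quasi_P μ h0
  have hM := quasi_M μ h0
  have hZ := quasi_Z μ
  have hI : gaugeD μ * 1 = (1 : ℝ) • (1 * gaugeD μ) := by simp
  have hPP := mul_quasi hP hP
  have hMM := mul_quasi hM hM
  have hZZ := mul_quasi hZ hZ
  have hPZ : gaugeD μ * spinPZ = μ • (spinPZ * gaugeD μ) := by
    rw [spinPZ, mul_add, mul_quasi hP hZ, mul_quasi hZ hP, add_mul, smul_add, mul_one, one_mul]
  have hMZ : gaugeD μ * spinMZ = μ⁻¹ • (spinMZ * gaugeD μ) := by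
    rw [spinMZ, mul_add, mul_quasi hM hZ, mul_quasi hZ hM, add_mul, smul_add, mul_one, one_mul]
  simp only [projPi, pow_two spinP, pow_two spinM, pow_two spinZ, mul_add, mul_sub, add_mul,
    sub_mul, mul_smul_comm, smul_mul_assoc]
  rw [kron_quasi hM hP (by field_simp) n, kron_quasi hP hM (by field_simp) n,
    kron_quasi hZ hZ (by simp) n, kron_quasi hI hI (by simp) n,
    kron_quasi hMM hPP (by field_simp) n, kron_quasi hPP hMM (by field_simp) n,
    kron_quasi hZZ hI (by simp) n, kron_quasi hI hZZ (by simp) n,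
    kron_quasi hMZ hPZ (by field_simp) n, kron_quasi hPZ hMZ (by field_simp) n,
    kron_quasi hZZ hZZ (by simp) n]
  match_scalars <;> field_simp
end

section
/- For every real μ > 0 and every natural number m: vᵀ · E_μ[Sᶻ] · (E_μ[U])^m · E_μ[Sᶻ] · v = (−4/9) · (−3μ/2)^{m+2} · (vᵀ v), where U := diag(−1, 1, −1) (the matrix of e^{iπSᶻ}). (Equivalently, the string order parameter ⟨Sᶻᵢ (∏_{k=i+1}^{j−1} e^{iπSᶻ_k}) Sᶻⱼ⟩ between the left and right ground states equals −4/9 for every separation, i.e. the string order does not decay.) -/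
open Matrix Kronecker

/-- The generalized 4×4 transfer matrix
`E_μ[O] = Σ_{i,j} O_{ij} (A_μ^{[i]})ᵀ ⊗ A_μ^{[j]}`, rows and columns indexed by
pairs `(α,β) ∈ {↑,↓}²` in the order `(↑↑,↑↓,↓↑,↓↓)`. -/
noncomputable def transferEgen (μ : ℝ) (O : Matrix (Fin 3) (Fin 3) ℝ) :
    Matrix (Fin 2 × Fin 2) (Fin 2 × Fin 2) ℝ :=
  ∑ i : Fin 3, ∑ j : Fin 3, O i j • ((asymA μ i)ᵀ ⊗ₖ (asymA μ j))

/-- The matrix of `e^{iπSᶻ} = diag(−1, 1, −1)` in the spin-1 basis. -/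
def stringU : Matrix (Fin 3) (Fin 3) ℝ := !![-1, 0, 0; 0, 1, 0; 0, 0, -1]

/-- The symmetric vector `(0, 1, 1, 0)`. -/
def symVec : Fin 2 × Fin 2 → ℝ := fun p => if p = (0, 1) then 1 else if p = (1, 0) then 1 else 0

lemma spinZ_mulVec_domVec (μ : ℝ) (hμ : 0 < μ) :
    (transferEgen μ spinZ).mulVec domVec = μ • symVec := by
  have h := Real.mul_self_sqrt hμ.le
  ext ⟨a, b⟩
  fin_cases a <;> fin_cases b <;>
    simp [transferEgen, spinZ, asymA, domVec, symVec, Matrix.mulVec, dotProduct,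
      Fintype.sum_prod_type, Fin.sum_univ_succ, Matrix.sum_apply, Matrix.kroneckerMap_apply, h]

lemma stringU_mulVec_symVec (μ : ℝ) (hμ : 0 < μ) :
    (transferEgen μ stringU).mulVec symVec = (-3*μ/2) • symVec := by
  have h := Real.mul_self_sqrt hμ.le
  have h2 : (√2 : ℝ)⁻¹ * (-μ / √2) = -μ / 2 := by
    have h3 : (√2 : ℝ) * √2 = 2 := Real.mul_self_sqrt (by norm_num)
    rw [← div_eq_inv_mul, div_div, h3]
  have h4 : (-μ / √2) * (√2 : ℝ)⁻¹ = -μ / 2 := by rw [mul_comm, h2]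
  ext ⟨a, b⟩
  fin_cases a <;> fin_cases b <;>
    simp [transferEgen, stringU, asymA, symVec, Matrix.mulVec, dotProduct,
      Fintype.sum_prod_type, Fin.sum_univ_succ, Matrix.sum_apply, Matrix.kroneckerMap_apply,
      h, h2, h4] <;> ring

lemma stringU_pow_mulVec_symVec (μ : ℝ) (hμ : 0 < μ) (m : ℕ) :
    ((transferEgen μ stringU) ^ m).mulVec symVec = (-3*μ/2) ^ m • symVec := by
  induction m with
  | zero => simp
  | succ k ih =>
    rw [pow_succ, ← Matrix.mulVec_mulVec, stringU_mulVec_symVec μ hμ, Matrix.mulVec_smul, ih,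
      smul_smul, pow_succ, mul_comm]

lemma domVec_spinZ_symVec (μ : ℝ) (hμ : 0 < μ) :
    domVec ⬝ᵥ (transferEgen μ spinZ).mulVec symVec = -2 * μ := by
  have h := Real.mul_self_sqrt hμ.le
  simp [transferEgen, spinZ, asymA, domVec, symVec, Matrix.mulVec, dotProduct,
      Fintype.sum_prod_type, Fin.sum_univ_succ, Matrix.sum_apply, Matrix.kroneckerMap_apply, h]
  ring

/-- for every `μ > 0` and every `m : ℕ`,
`vᵀ · E_μ[Sᶻ] · (E_μ[U])^m · E_μ[Sᶻ] · v = (−4/9) · (−3μ/2)^{m+2} · (vᵀv)`: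
the string order parameter between the left and right ground states equals
`−4/9` at every separation, i.e. the string order does not decay. -/
theorem stmt18 (μ : ℝ) (hμ : 0 < μ) (m : ℕ) :
    domVec ⬝ᵥ
        (transferEgen μ spinZ * (transferEgen μ stringU) ^ m * transferEgen μ spinZ).mulVec
          domVec =
      (-4/9 : ℝ) * (-3*μ/2) ^ (m + 2) * (domVec ⬝ᵥ domVec) := by
  have hd : domVec ⬝ᵥ domVec = 2 := by
    simp [domVec, dotProduct, Fintype.sum_prod_type, Fin.sum_univ_succ]
    norm_num
  rw [← Matrix.mulVec_mulVec, ← Matrix.mulVec_mulVec, spinZ_mulVec_domVec μ hμ,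
    Matrix.mulVec_smul, stringU_pow_mulVec_symVec μ hμ, Matrix.mulVec_smul, Matrix.mulVec_smul,
    dotProduct_smul, dotProduct_smul, domVec_spinZ_symVec μ hμ, hd]
  simp only [smul_eq_mul]
  ring
end

section
/- For every real μ > 0, every integer N ≥ 2, and every site index j (indices taken modulo N), the periodic-boundary asymmetric AKLT state Φ_μ, defined componentwise by Φ_μ(i₁, …, i_N) := Tr(A_μ^{[i₁]} A_μ^{[i₂]} ⋯ A_μ^{[i_N]}) for (i₁,…,i_N) ∈ {+1,0,−1}^N, is annihilated by the local term Π(μ) acting on the pair of sites (j, j+1 mod N): for every tuple (i₁,…,i_N), Σ_{i'_j, i'_{j+1} ∈ {+1,0,−1}} Π(μ)_{(i_j, i_{j+1}), (i'_j, i'_{j+1})} · Φ_μ(i₁, …, i'_j, i'_{j+1}, …, i_N) = 0. Hence Φ_μ is a zero-energy eigenstate of the non-Hermitian parent Hamiltonian H(μ) = Σⱼ Π(μ)_{j,j+1}. -/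
open Matrix Kronecker

/-- The periodic-boundary asymmetric AKLT state, defined componentwise by
`Φ_μ(i₁,…,i_N) = Tr(A_μ^{[i₁]} A_μ^{[i₂]} ⋯ A_μ^{[i_N]})`. -/
noncomputable def asymAKLT (μ : ℝ) {N : ℕ} (i : Fin N → Fin 3) : ℝ :=
  ((List.ofFn fun k => asymA μ (i k)).prod).trace

/-- Replacing one entry of the tuple is `List.set` on the list of matrices. -/
lemma ofFn_update_aux {N : ℕ} (F : Fin 3 → Matrix (Fin 2) (Fin 2) ℝ) (i : Fin N → Fin 3)
    (j : Fin N) (a : Fin 3) :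
    (List.ofFn fun k => F (Function.update i j a k))
      = (List.ofFn fun k => F (i k)).set j (F a) := by
  apply List.ext_getElem
  · simp
  · intro n h1 h2
    simp only [List.getElem_ofFn, List.getElem_set]
    split_ifs with h
    · have : (⟨n, by simpa using h1⟩ : Fin N) = j := Fin.ext h.symm
      rw [this]; simp
    · rw [Function.update_of_ne]
      intro h'
      exact h (by rw [← h'])

/-- By cyclicity of the trace, the amplitude is `Tr (A a * A b * X)`. -/
lemma asymAKLT_update_aux (μ : ℝ) (N : ℕ) (hN : 2 ≤ N)
    (j j' : Fin N) (hj' : (j' : ℕ) = ((j : ℕ) + 1) % N) (i : Fin N → Fin 3) :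
    ∃ X : Matrix (Fin 2) (Fin 2) ℝ, ∀ a b,
      asymAKLT μ (Function.update (Function.update i j a) j' b)
        = (asymA μ a * asymA μ b * X).trace := by
  have hj := j.2
  set L := List.ofFn fun k => asymA μ (i k) with hL
  have hlen : L.length = N := by simp [hL]
  by_cases h : (j : ℕ) + 1 < N
  · rw [Nat.mod_eq_of_lt h] at hj'
    refine ⟨(L.drop (j + 2)).prod * (L.take j).prod, fun a b => ?_⟩
    unfold asymAKLT
    rw [ofFn_update_aux (asymA μ), ofFn_update_aux (asymA μ), ← hL, hj', List.prod_set,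
      List.take_set, List.prod_set, List.drop_set_of_lt (by omega)]
    rw [if_pos (by simp [hlen]), if_pos (by simp [hlen]; omega)]
    have h3 : List.drop (↑j + 1) (List.take (↑j + 1) L) = [] := by simp
    rw [h3, List.take_take, min_eq_left (by omega), List.prod_nil, mul_one]
    rw [← Matrix.mul_assoc, Matrix.trace_mul_comm _ (List.take (↑j) L).prod]
    simp only [Matrix.mul_assoc]
  · have hjN : (j : ℕ) + 1 = N := by omega
    rw [hjN, Nat.mod_self] at hj'
    refine ⟨((L.drop 1).take (j - 1)).prod, fun a b => ?_⟩
    unfold asymAKLT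
    rw [ofFn_update_aux (asymA μ), ofFn_update_aux (asymA μ), ← hL, hj', List.prod_set,
      List.drop_set, if_neg (show ¬ (j : ℕ) < 0 + 1 by omega), List.prod_set]
    rw [if_pos (by simp [hlen]; omega), if_pos (by simp [hlen]; omega)]
    have h3 : List.drop (↑j - (0 + 1) + 1) (List.drop (0 + 1) L) = [] := by
      simp [hlen]; omega
    rw [h3, List.prod_nil, mul_one, List.take_zero, List.prod_nil, one_mul,
      ← Matrix.mul_assoc, Matrix.trace_mul_comm, ← Matrix.mul_assoc]

lemma spinM_aux : spinM = !![0, 0, 0; √2, 0, 0; 0, √2, 0] := by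
  ext a b; fin_cases a <;> fin_cases b <;> simp [spinM, spinP]

lemma spinPZ_aux : spinPZ = !![0, √2, 0; 0, 0, -√2; 0, 0, 0] := by
  ext a b; fin_cases a <;> fin_cases b <;>
    simp [spinPZ, spinP, spinZ]

lemma spinMZ_aux : spinMZ = !![0, 0, 0; √2, 0, 0; 0, -√2, 0] := by
  ext a b; fin_cases a <;> fin_cases b <;>
    simp [spinMZ, spinM_aux, spinZ]

/-- The local term annihilates the two-site tensor. -/
lemma projPi_local_aux (μ : ℝ) (hμ : 0 < μ) (p q : Fin 3) (X : Matrix (Fin 2) (Fin 2) ℝ) :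
    ∑ a : Fin 3, ∑ b : Fin 3,
      projPi μ (p, q) (a, b) * (asymA μ a * asymA μ b * X).trace = 0 := by
  obtain ⟨s, hs, rfl⟩ : ∃ s : ℝ, 0 < s ∧ μ = s ^ 2 :=
    ⟨√μ, Real.sqrt_pos.2 hμ, (Real.sq_sqrt hμ.le).symm⟩
  have hs' : √(s ^ 2) = s := Real.sqrt_sq hs.le
  have hr : √2 ^ 2 = (2 : ℝ) := Real.sq_sqrt (by norm_num)
  have hr0 : (0 : ℝ) < √2 := by positivity
  have hr4 : √2 ^ 4 = (4 : ℝ) := by rw [show √2 ^ 4 = (√2 ^ 2) ^ 2 by ring, hr]; norm_num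
  fin_cases p <;> fin_cases q <;>
    simp [projPi, asymA, spinM_aux, spinP, spinZ, spinPZ_aux, spinMZ_aux, Fin.sum_univ_three,
      pow_two (M := Matrix (Fin 3) (Fin 3) ℝ),
      Matrix.trace_fin_two, Matrix.mul_apply, Matrix.one_apply, hs']
  all_goals field_simp
  all_goals (try simp only [hr, hr4])
  all_goals ring

theorem stmt19 (μ : ℝ) (hμ : 0 < μ) (N : ℕ) (hN : 2 ≤ N)
    (j j' : Fin N) (hj' : (j' : ℕ) = ((j : ℕ) + 1) % N)
    (i : Fin N → Fin 3) :
    ∑ a : Fin 3, ∑ b : Fin 3,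
        projPi μ (i j, i j') (a, b) *
          asymAKLT μ (Function.update (Function.update i j a) j' b) = 0 := by
  obtain ⟨X, hX⟩ := asymAKLT_update_aux μ N hN j j' hj' i
  simp only [hX]
  exact projPi_local_aux μ hμ _ _ X
end
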